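/- Let Λ_K3 = U ⊕ U ⊕ U ⊕ E8(−1) ⊕ E8(−1) be the K3 lattice, and let l ∈ Λ_K3 be a primitive vector with ⟨l,l⟩ = 2n > 0. Then the orthogonal complement l^⊥ = {v ∈ Λ_K3 : ⟨v,l⟩ = 0}, with the restricted bilinear form, is isometric to ℤl* ⊕ U ⊕ U ⊕ E8(−1) ⊕ E8(−1), where ℤl* denotes the rank-one lattice ℤ with bilinear form (x,y) ↦ −2nxy (so ⟨l*, l*⟩ = −2n). -/

import Mathlib

open Matrix

/-- Gram matrix of the hyperbolic plane `U`. -/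
def gramU : Matrix (Fin 2) (Fin 2) ℤ := !![0, 1; 1, 0]

/-- Gram matrix of `E8(−1)`, the negative of the E₈ Cartan (Gram) matrix. -/
def gramE8neg : Matrix (Fin 8) (Fin 8) ℤ := - CartanMatrix.E₈

/-- Index type for the lattice `U^a ⊕ E8(−1)^b`. -/
abbrev IdxL (a b : ℕ) := (Fin 2 × Fin a) ⊕ (Fin 8 × Fin b)

/-- Gram matrix of `U^a ⊕ E8(−1)^b`. -/
def gramL (a b : ℕ) : Matrix (IdxL a b) (IdxL a b) ℤ :=
  Matrix.fromBlocks (Matrix.blockDiagonal fun _ => gramU) 0 0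
    (Matrix.blockDiagonal fun _ => gramE8neg)

/-- Index type of the K3 lattice `Λ_K3 = U³ ⊕ E8(−1)²`. -/
abbrev IdxK3 := IdxL 3 2

/-- The bilinear form of the K3 lattice. -/
def bilK3 (x y : IdxK3 → ℤ) : ℤ := x ⬝ᵥ (gramL 3 2).mulVec y

/-- Index type for `ℤl* ⊕ U ⊕ U ⊕ E8(−1) ⊕ E8(−1)`. -/
abbrev Idx' := Fin 1 ⊕ IdxL 2 2

/-- Gram matrix of `ℤl* ⊕ U² ⊕ E8(−1)²`, where `⟨l*,l*⟩ = −2n`. -/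
def gram' (n : ℕ) : Matrix Idx' Idx' ℤ :=
  Matrix.fromBlocks (Matrix.diagonal fun _ => -(2 * (n : ℤ))) 0 0 (gramL 2 2)

/-- The orthogonal complement `l^⊥ = {v ∈ Λ_K3 : ⟨v,l⟩ = 0}`. -/
def perpK3 (l : IdxK3 → ℤ) : Submodule ℤ (IdxK3 → ℤ) where
  carrier := {v | bilK3 v l = 0}
  zero_mem' := by simp [bilK3]
  add_mem' := by
    intro u v hu hv
    simp only [Set.mem_setOf_eq, bilK3, add_dotProduct] at *
    omega
  smul_mem' := by
    intro c v hv
    simp only [Set.mem_setOf_eq, bilK3, smul_dotProduct, smul_eq_mul] at *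
    simp [hv]

section Hyperbolic

open LinearMap (BilinForm)

variable {K M : Type*} [AddCommGroup K] [AddCommGroup M]

/-- The orthogonal sum `U ⊕ K` of the hyperbolic plane and the lattice `(K, b)`. -/
def hypSum (b : BilinForm ℤ K) : BilinForm ℤ (ℤ × ℤ × K) :=
  LinearMap.mk₂ ℤ (fun x y => x.1 * y.2.1 + x.2.1 * y.1 + b x.2.2 y.2.2)
    (by intros; simp; ring) (by intros; simp; ring)
    (by intros; simp; ring) (by intros; simp; ring)

@[simp] lemma hypSum_apply (b : BilinForm ℤ K) (x y : ℤ × ℤ × K) :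
    hypSum b x y = x.1 * y.2.1 + x.2.1 * y.1 + b x.2.2 y.2.2 := rfl

lemma hypSum_symm {b : BilinForm ℤ K} (hs : ∀ x y, b x y = b y x) (x y : ℤ × ℤ × K) :
    hypSum b x y = hypSum b y x := by
  simp only [hypSum_apply, hs x.2.2]; ring

lemma hypSum_even {b : BilinForm ℤ K} (he : ∀ x, Even (b x x)) (x : ℤ × ℤ × K) :
    Even (hypSum b x x) := by
  obtain ⟨q, hq⟩ := he x.2.2
  exact ⟨x.1 * x.2.1 + q, by rw [hypSum_apply, hq]; ring⟩

/-- Two vectors lie in the same orbit of the isometry group of `b`. -/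
def SameOrbit (b : BilinForm ℤ M) (v w : M) : Prop :=
  ∃ φ : M ≃ₗ[ℤ] M, (∀ x y, b (φ x) (φ y) = b x y) ∧ φ v = w

lemma SameOrbit.refl (b : BilinForm ℤ M) (v : M) : SameOrbit b v v :=
  ⟨LinearEquiv.refl ℤ M, fun _ _ => rfl, rfl⟩

lemma SameOrbit.trans {b : BilinForm ℤ M} {u v w : M} (h : SameOrbit b u v)
    (h' : SameOrbit b v w) : SameOrbit b u w := by
  obtain ⟨φ, hφ, rfl⟩ := h
  obtain ⟨ψ, hψ, rfl⟩ := h'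
  exact ⟨φ.trans ψ, fun x y => by simp [hφ, hψ], rfl⟩

lemma SameOrbit.norm_eq {b : BilinForm ℤ M} {v w : M} (h : SameOrbit b v w) :
    b w w = b v v := by
  obtain ⟨φ, hφ, rfl⟩ := h
  exact hφ v v

lemma SameOrbit.exists_eq_one {b : BilinForm ℤ M} {v w : M} (h : SameOrbit b v w)
    (hv : ∃ y, b y v = 1) : ∃ y, b y w = 1 := by
  obtain ⟨φ, hφ, rfl⟩ := h
  obtain ⟨y, hy⟩ := hv
  exact ⟨φ y, by rw [hφ, hy]⟩

lemma sameOrbit_neg (b : BilinForm ℤ M) (v : M) : SameOrbit b v (-v) :=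
  ⟨LinearEquiv.neg ℤ, by simp, rfl⟩

lemma sameOrbit_flip (b : BilinForm ℤ K) (a c : ℤ) (x : K) :
    SameOrbit (hypSum b) (a, c, x) (c, a, x) :=
  ⟨{ toFun := fun z => (z.2.1, z.1, z.2.2)
     invFun := fun z => (z.2.1, z.1, z.2.2)
     map_add' := fun _ _ => rfl
     map_smul' := fun _ _ => rfl
     left_inv := fun _ => rfl
     right_inv := fun _ => rfl },
   fun x y => by simp; ring, rfl⟩

lemma sameOrbit_swap (b : BilinForm ℤ K) (a c a' c' : ℤ) (x : K) :
    SameOrbit (hypSum (hypSum b)) (a, c, a', c', x) (a', c', a, c, x) :=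
  ⟨{ toFun := fun z => (z.2.2.1, z.2.2.2.1, z.1, z.2.1, z.2.2.2.2)
     invFun := fun z => (z.2.2.1, z.2.2.2.1, z.1, z.2.1, z.2.2.2.2)
     map_add' := fun _ _ => rfl
     map_smul' := fun _ _ => rfl
     left_inv := fun _ => rfl
     right_inv := fun _ => rfl },
   fun x y => by simp; ring, rfl⟩

/-- The Eichler transvection of `U ⊕ K` attached to `k : K` with `b k k = 2 * q`. -/
lemma sameOrbit_transvection {b : BilinForm ℤ K} (hs : ∀ x y, b x y = b y x) {k : K} {q : ℤ}
    (hq : b k k = q + q) (a c : ℤ) (x : K) :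
    SameOrbit (hypSum b) (a, c, x) (a, c - b k x - q * a, x + a • k) :=
  ⟨{ toFun := fun z => (z.1, z.2.1 - b k z.2.2 - q * z.1, z.2.2 + z.1 • k)
     invFun := fun z => (z.1, z.2.1 + b k z.2.2 - q * z.1, z.2.2 - z.1 • k)
     map_add' := fun y z => by
       ext
       · rfl
       · simp; ring
       · simp only [Prod.fst_add, Prod.snd_add, add_smul]; abel
     map_smul' := fun m z => by
       ext
       · rfl
       · simp; ring
       · simp [mul_smul]
     left_inv := fun z => by
       ext
       · rfl
       · simp [hq]; ring
       · simp
     right_inv := fun z => by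
       ext
       · rfl
       · simp [hq]; ring
       · simp },
   fun y z => by
     simp [hq, hs y.2.2 k]; ring, rfl⟩

variable {b : BilinForm ℤ K}

/-- If `a` divides the third coordinate of every vector in the orbit of `v = (a, …)`, then
`a` divides every value of the form at `v`. -/
lemma dvd_of_forall_sameOrbit (hs : ∀ x y, b x y = b y x) (he : ∀ x, Even (b x x))
    (a : ℤ) (z : ℤ × ℤ × ℤ × K)
    (h : ∀ c p r x, SameOrbit (hypSum (hypSum b)) (a, z) (a, c, p, r, x) → a ∣ p)
    (y : ℤ × ℤ × ℤ × ℤ × K) : a ∣ hypSum (hypSum b) y (a, z) := by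
  have hs' := hypSum_symm hs
  obtain ⟨c, p, r, x⟩ := z
  have hp : a ∣ p := h _ _ _ _ (.refl _ _)
  have hr : a ∣ r := by
    refine h c r p x ?_
    exact (sameOrbit_swap b _ _ _ _ _).trans <| (sameOrbit_flip _ _ _ _).trans
      (sameOrbit_swap b _ _ _ _ _)
  obtain ⟨s, rfl⟩ := hp
  obtain ⟨t, rfl⟩ := hr
  obtain ⟨c', hc', hcc⟩ : ∃ c', SameOrbit (hypSum (hypSum b)) (a, c, a * s, a * t, x)
      (a, c', 0, 0, x) ∧ a ∣ c' - c := by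
    obtain ⟨q, hq⟩ := hypSum_even he ((-s, -t, 0) : ℤ × ℤ × K)
    refine ⟨c + (2 * s * t - q) * a, ?_, by simp⟩
    convert sameOrbit_transvection hs' hq a c (a * s, a * t, x) using 2
    simp
    ring
  have key (k : ℤ × ℤ × K) : a ∣ hypSum b k (a, c', x) := by
    obtain ⟨q, hq⟩ := hypSum_even he k
    have ht := sameOrbit_transvection hs' hq 0 0 (a, c', x)
    simp only [sub_zero, mul_zero, zero_smul, add_zero, zero_sub] at ht
    rw [← dvd_neg]
    exact h c' _ 0 x <| hc'.trans <| (sameOrbit_swap b _ _ _ _ _).trans <|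
      ht.trans <| (sameOrbit_flip _ _ _ _).trans <| sameOrbit_swap b _ _ _ _ _
  have hac : a ∣ c := by
    rw [← dvd_sub_right (b := c') (by simpa using key (1, 0, 0))]
    exact hcc
  have hk := key (0, 0, y.2.2.2.2)
  simp only [hypSum_apply, zero_mul, zero_add] at hk ⊢
  refine dvd_add (dvd_add (hac.mul_left _) (dvd_mul_left _ _)) (dvd_add (dvd_add ?_ ?_) hk)
  · exact (dvd_mul_right _ _).mul_left _
  · exact (dvd_mul_right _ _).mul_left _

/-- The orbit of a unimodular vector contains a vector with first coordinate `1`. -/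
lemma exists_sameOrbit_one (hs : ∀ x y, b x y = b y x) (he : ∀ x, Even (b x x))
    (v : ℤ × ℤ × ℤ × ℤ × K) (hv : ∃ y, hypSum (hypSum b) y v = 1) :
    ∃ z, SameOrbit (hypSum (hypSum b)) v (1, z) := by
  classical
  by_cases h0 : ∃ a : ℕ, 0 < a ∧ ∃ z, SameOrbit (hypSum (hypSum b)) v ((a : ℤ), z)
  · obtain ⟨ha, z, hz⟩ := Nat.find_spec h0
    have hmin := fun m => Nat.find_min (m := m) h0
    set a := Nat.find h0
    suffices h : ∀ c p r x,
        SameOrbit (hypSum (hypSum b)) ((a : ℤ), z) (a, c, p, r, x) → (a : ℤ) ∣ p by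
      obtain ⟨y, hy⟩ := hz.exists_eq_one hv
      have h1 : (a : ℤ) ∣ 1 := hy ▸ dvd_of_forall_sameOrbit hs he a z h y
      have ha1 : (a : ℤ) = 1 := Int.eq_one_of_dvd_one (by positivity) h1
      exact ⟨z, ha1 ▸ hz⟩
    intro c p r x h
    obtain ⟨q, hq⟩ := hypSum_even he ((-(p / a), 0, 0) : ℤ × ℤ × K)
    have ht := (hz.trans h).trans <|
      (sameOrbit_transvection (hypSum_symm hs) hq a c (p, r, x)).trans (sameOrbit_swap b _ _ _ _ _)
    have hpa : p + a * -(p / a) = p % a := by rw [Int.emod_def]; ring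
    simp only [Prod.smul_mk, smul_eq_mul, hpa] at ht
    have hpos : 0 ≤ p % (a : ℤ) := Int.emod_nonneg _ (by positivity)
    have hlt : p % (a : ℤ) < a := Int.emod_lt_of_pos _ (by positivity)
    by_contra hdvd
    have hne : p % (a : ℤ) ≠ 0 := fun h => hdvd (Int.dvd_of_emod_eq_zero h)
    refine hmin (p % (a : ℤ)).toNat (by omega) ⟨by omega, ?_⟩
    rw [Int.toNat_of_nonneg hpos]
    exact ⟨_, ht⟩
  · have hzero (a : ℤ) (z) (h : SameOrbit (hypSum (hypSum b)) v (a, z)) : a = 0 := by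
      by_contra ha
      rcases lt_or_gt_of_ne ha with h' | h'
      · refine h0 ⟨(-a).toNat, by omega, -z, ?_⟩
        rw [Int.toNat_of_nonneg (by omega)]
        exact h.trans (sameOrbit_neg _ _)
      · refine h0 ⟨a.toNat, by omega, z, ?_⟩
        rwa [Int.toNat_of_nonneg h'.le]
    obtain ⟨a, z⟩ := v
    obtain rfl := hzero a z (.refl _ _)
    obtain ⟨y, hy⟩ := hv
    have h1 := hy ▸ dvd_of_forall_sameOrbit hs he 0 z
      (fun c p r x h => zero_dvd_iff.2 <|
        hzero p _ (h.trans (sameOrbit_swap b _ _ _ _ _))) y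
    simp at h1

/-- Eichler's criterion for unimodular vectors of `U ⊕ U ⊕ K`. -/
theorem sameOrbit_standard (hs : ∀ x y, b x y = b y x) (he : ∀ x, Even (b x x))
    (v : ℤ × ℤ × ℤ × ℤ × K) (hv : ∃ y, hypSum (hypSum b) y v = 1) (n : ℤ)
    (hn : hypSum (hypSum b) v v = 2 * n) :
    SameOrbit (hypSum (hypSum b)) v (1, n, 0) := by
  obtain ⟨⟨c, x⟩, h⟩ := exists_sameOrbit_one hs he v hv
  obtain ⟨q, hq⟩ := hypSum_even he (-x)
  have ht := h.trans (sameOrbit_transvection (hypSum_symm hs) hq 1 c x)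
  rw [one_smul, add_neg_cancel] at ht
  generalize c - hypSum b (-x) x - q * 1 = c' at ht
  have hc : c' = n := by
    have := ht.norm_eq.trans hn
    rw [hypSum_apply] at this
    simp only [map_zero] at this
    linarith
  exact hc ▸ ht

end Hyperbolic

section Gram

/-- The upper triangular matrix `A` with `A + Aᵀ = gramL a b`, showing that `gramL a b` is even. -/
def halfGramL (a b : ℕ) : Matrix (IdxL a b) (IdxL a b) ℤ :=
  Matrix.fromBlocks (Matrix.blockDiagonal fun _ => !![0, 1; 0, 0]) 0 0
    (Matrix.blockDiagonal fun _ =>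
      Matrix.of fun i j => if i < j then gramE8neg i j else if i = j then -1 else 0)

lemma halfGramL_add_transpose (a b : ℕ) : halfGramL a b + (halfGramL a b)ᵀ = gramL a b := by
  have hU : !![0, 1; 0, 0] + !![0, 1; 0, 0]ᵀ = gramU := by decide
  have hE : (Matrix.of fun i j => if i < j then gramE8neg i j else if i = j then -1 else 0) +
      (Matrix.of fun i j => if i < j then gramE8neg i j else if i = j then -1 else 0)ᵀ
      = gramE8neg := by decide
  simp only [halfGramL, gramL, fromBlocks_transpose, blockDiagonal_transpose, fromBlocks_add,
    ← blockDiagonal_add, Pi.add_def, hU, hE, transpose_zero, add_zero]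

lemma gramL_isSymm (a b : ℕ) : (gramL a b).IsSymm := by
  rw [Matrix.IsSymm, ← halfGramL_add_transpose, transpose_add, transpose_transpose, add_comm]

lemma isUnit_det_gramL (a b : ℕ) : IsUnit (gramL a b).det := by
  have hU : gramU.det = -1 := by decide
  have hE : gramE8neg.det = 1 := by
    simp [gramE8neg, det_neg, CartanMatrix.E₈_det]
  simpa [gramL, det_blockDiagonal, hU, hE] using isUnit_one.neg.pow a

/-- The bilinear form of `U^a ⊕ E8(−1)^b`. -/
noncomputable def formL (a b : ℕ) : LinearMap.BilinForm ℤ (IdxL a b → ℤ) :=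
  Matrix.toBilin' (gramL a b)

lemma formL_apply (a b : ℕ) (x y : IdxL a b → ℤ) :
    formL a b x y = x ⬝ᵥ (gramL a b).mulVec y := Matrix.toBilin'_apply' _ _ _

lemma formL_symm (a b : ℕ) (x y : IdxL a b → ℤ) : formL a b x y = formL a b y x := by
  rw [formL_apply, formL_apply, dotProduct_mulVec, dotProduct_comm, ← mulVec_transpose,
    gramL_isSymm]

lemma formL_even (a b : ℕ) (x : IdxL a b → ℤ) : Even (formL a b x x) := by
  refine ⟨x ⬝ᵥ (halfGramL a b).mulVec x, ?_⟩
  rw [formL_apply, ← halfGramL_add_transpose, add_mulVec, dotProduct_add, mulVec_transpose,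
    dotProduct_comm x (x ᵥ* _), dotProduct_mulVec]

lemma exists_formL_eq_one (a b : ℕ) (l : IdxL a b → ℤ)
    (hprim : ¬ ∃ (w : IdxL a b → ℤ) (m : ℤ), 2 ≤ |m| ∧ l = m • w) :
    ∃ y, formL a b y l = 1 := by
  obtain ⟨g, hg⟩ := (inferInstance : (LinearMap.range ((formL a b).flip l)).IsPrincipal)
  have hdvd (i : IdxL a b) : g ∣ l i := by
    have h : formL a b (Pi.single i 1 ᵥ* (gramL a b)⁻¹) l = l i := by
      rw [formL_apply, dotProduct_mulVec, vecMul_vecMul, nonsing_inv_mul _ (isUnit_det_gramL a b),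
        vecMul_one, single_one_dotProduct]
    rw [← Ideal.mem_span_singleton, Ideal.span, ← hg]
    exact ⟨_, h⟩
  choose w hw using hdvd
  have hlt : ¬ 2 ≤ |g| := fun h => hprim ⟨w, g, h, funext hw⟩
  have hg0 : g ≠ 0 := by
    rintro rfl
    exact hprim ⟨0, 2, by norm_num, funext fun i => by simp [hw]⟩
  have hunit : IsUnit g := by
    rw [Int.isUnit_iff_abs_eq]
    have := abs_pos.2 hg0
    omega
  have h1 : (1 : ℤ) ∈ LinearMap.range ((formL a b).flip l) := by
    rw [hg]
    exact Ideal.mem_span_singleton.2 hunit.dvd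
  exact h1

/-- Splitting off the first hyperbolic plane of `U^(a+1) ⊕ E8(−1)^b`. -/
def splitU (a b : ℕ) : (IdxL (a + 1) b → ℤ) ≃ₗ[ℤ] ℤ × ℤ × (IdxL a b → ℤ) where
  toFun x := (x (.inl (0, 0)), x (.inl (1, 0)), fun s => x (s.map (Prod.map id Fin.succ) id))
  invFun z := Sum.elim (fun p => Fin.cases (![z.1, z.2.1] p.1) (fun j => z.2.2 (.inl (p.1, j))) p.2)
    fun p => z.2.2 (.inr p)
  map_add' _ _ := rfl
  map_smul' _ _ := rfl
  left_inv x := by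
    ext (⟨i, j⟩ | p)
    · cases j using Fin.cases
      · fin_cases i <;> rfl
      · rfl
    · rfl
  right_inv z := by
    ext s
    · rfl
    · rfl
    · rcases s with p | p <;> rfl

lemma formL_eq_sum (a b : ℕ) (x y : IdxL a b → ℤ) :
    formL a b x y =
      ∑ j, (x (.inl (0, j)) * y (.inl (1, j)) + x (.inl (1, j)) * y (.inl (0, j))) +
      ∑ i, ∑ k, x (.inr (i, k)) * ∑ j, gramE8neg i j * y (.inr (j, k)) := by
  simp [formL_apply, gramL, gramU, dotProduct, mulVec, blockDiagonal_apply,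
    Fintype.sum_prod_type, Fin.sum_univ_two, Finset.sum_add_distrib]

lemma hypSum_splitU (a b : ℕ) (x y : IdxL (a + 1) b → ℤ) :
    hypSum (formL a b) (splitU a b x) (splitU a b y) = formL (a + 1) b x y := by
  simp [formL_eq_sum, splitU, Fin.sum_univ_succ (n := a)]
  ring

end Gram

open LinearMap (BilinForm) in
/-- If `e : M ≃ U ⊕ K` is an isometry sending `l` to `(1, n, 0)`, then `l^⊥ ≃ ⟨-2n⟩ ⊕ K`. -/
lemma exists_perp_equiv {M K : Type*} [AddCommGroup M] [AddCommGroup K]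
    {B : BilinForm ℤ M} {b : BilinForm ℤ K} {P : Submodule ℤ M} {l : M} {n : ℤ}
    (hP : ∀ v, v ∈ P ↔ B v l = 0) (e : M ≃ₗ[ℤ] ℤ × ℤ × K)
    (he : ∀ x y, hypSum b (e x) (e y) = B x y) (hl : e l = (1, n, 0)) :
    ∃ g : P ≃ₗ[ℤ] ℤ × K, ∀ x y : P,
      -(2 * n) * ((g x).1 * (g y).1) + b (g x).2 (g y).2 = B x y := by
  have hmem (v : M) : v ∈ P ↔ (e v).2.1 = -(n * (e v).1) := by
    rw [hP, ← he, hl, hypSum_apply, map_zero]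
    constructor <;> intro h <;> linarith
  refine ⟨{ toFun := fun x => ((e x).1, (e x).2.2)
            invFun := fun z => ⟨e.symm (z.1, -(n * z.1), z.2), by simp [hmem]⟩
            map_add' := fun x y => by simp
            map_smul' := fun m x => by simp
            left_inv := fun x => by
              ext
              simp only [← (hmem x).1 x.2, Prod.mk.eta, e.symm_apply_apply]
            right_inv := fun z => by simp }, fun x y => ?_⟩
  rw [← he, hypSum_apply, (hmem x).1 x.2, (hmem y).1 y.2]
  simp
  ring

/-- The identification of `ℤl* ⊕ (U² ⊕ E8(−1)²)` with functions on `Idx'`. -/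
def prodEquivIdx' : (ℤ × (IdxL 2 2 → ℤ)) ≃ₗ[ℤ] (Idx' → ℤ) where
  toFun z := Sum.elim (fun _ => z.1) z.2
  invFun f := (f (.inl 0), fun s => f (.inr s))
  map_add' _ _ := by ext (i | s) <;> rfl
  map_smul' _ _ := by ext (i | s) <;> rfl
  left_inv _ := rfl
  right_inv f := by
    ext (i | s)
    · fin_cases i; rfl
    · rfl

lemma prodEquivIdx'_gram' (n : ℕ) (z w : ℤ × (IdxL 2 2 → ℤ)) :
    prodEquivIdx' z ⬝ᵥ (gram' n).mulVec (prodEquivIdx' w) =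
      -(2 * n) * (z.1 * w.1) + formL 2 2 z.2 w.2 := by
  change Sum.elim _ _ ⬝ᵥ (gram' n).mulVec (Sum.elim _ _) = _
  rw [gram', fromBlocks_mulVec, formL_apply]
  simp [Function.comp_def, dotProduct]
  ring

/-- if `l ∈ Λ_K3` is primitive with `⟨l,l⟩ = 2n > 0`, then `l^⊥` with the
restricted form is isometric to `ℤl* ⊕ U ⊕ U ⊕ E8(−1) ⊕ E8(−1)` with `⟨l*,l*⟩ = −2n`. -/
theorem statement15 (n : ℕ) (hn : 1 ≤ n) (l : IdxK3 → ℤ)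
    (hprim : ¬ ∃ (w : IdxK3 → ℤ) (m : ℤ), 2 ≤ |m| ∧ l = m • w)
    (hl : bilK3 l l = 2 * n) :
    ∃ g : perpK3 l ≃ₗ[ℤ] (Idx' → ℤ),
      ∀ x y : perpK3 l, (g x) ⬝ᵥ (gram' n).mulVec (g y) = bilK3 (x : IdxK3 → ℤ) (y : IdxK3 → ℤ) := by
  have hadj (x y : IdxK3 → ℤ) : formL 3 2 x y = bilK3 x y := formL_apply 3 2 x y
  let s : (IdxK3 → ℤ) ≃ₗ[ℤ] ℤ × ℤ × (IdxL 2 2 → ℤ) := splitU 2 2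
  let t : (ℤ × ℤ × (IdxL 2 2 → ℤ)) ≃ₗ[ℤ] ℤ × ℤ × ℤ × ℤ × (IdxL 1 2 → ℤ) :=
    (LinearEquiv.refl ℤ ℤ).prodCongr ((LinearEquiv.refl ℤ ℤ).prodCongr (splitU 1 2))
  have hs (x y : IdxK3 → ℤ) : hypSum (formL 2 2) (s x) (s y) = formL 3 2 x y :=
    hypSum_splitU 2 2 x y
  have ht (x y : ℤ × ℤ × (IdxL 2 2 → ℤ)) :
      hypSum (hypSum (formL 1 2)) (t x) (t y) = hypSum (formL 2 2) x y := by
    rw [hypSum_apply (formL 2 2), ← hypSum_splitU]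
    rfl
  obtain ⟨y, hy⟩ := exists_formL_eq_one 3 2 l hprim
  obtain ⟨φ, hφ, hφl⟩ := sameOrbit_standard (formL_symm 1 2) (formL_even 1 2) (t (s l))
    ⟨t (s y), by rw [ht, hs, hy]⟩ n (by rw [ht, hs, hadj, hl])
  have he (x y) : hypSum (formL 2 2) (((s.trans t).trans (φ.trans t.symm)) x)
      (((s.trans t).trans (φ.trans t.symm)) y) = formL 3 2 x y := by
    rw [← hs, ← ht, ← ht (s x), ← hφ (t (s x))]
    simp only [LinearEquiv.trans_apply, LinearEquiv.apply_symm_apply]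
  have hel : ((s.trans t).trans (φ.trans t.symm)) l = (1, (n : ℤ), 0) := by
    simp only [LinearEquiv.trans_apply, hφl, LinearEquiv.symm_apply_eq]
    simp [t]
  obtain ⟨g, hg⟩ := exists_perp_equiv (P := perpK3 l) (fun v => by rw [hadj]; rfl) _ he hel
  refine ⟨g.trans prodEquivIdx', fun x y => ?_⟩
  rw [← hadj, ← hg]
  exact prodEquivIdx'_gram' n _ _
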